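/- arXiv:1605.03074 — 2 statements merged into one kernel-verified Lean document; each statement's English description precedes it below -/
import Mathlib

section
/- Let d ∈ {1,2,3} and m ∈ {2,3}. Then every natural number n can be written as n = x^2 + y^2 + z^2 + w^2 with x, y, z, w integers such that x + 2y + 2z = d·t^m for some integer t. -/
theorem exists_shift_two_mul_abs_le (a : ℤ) (ha : 0 < a) (b : ℤ) :
    ∃ k : ℤ, -a ≤ 2 * (b + k * a) ∧ 2 * (b + k * a) ≤ a := by
  refine ⟨-((2 * b + a) / (2 * a)), ?_⟩
  have h1 := Int.emod_add_mul_ediv (2 * b + a) (2 * a)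
  have h2 := Int.emod_nonneg (2 * b + a) (show 2 * a ≠ 0 by omega)
  have h3 := Int.emod_lt_of_pos (2 * b + a) (show 0 < 2 * a by omega)
  constructor <;> nlinarith

theorem exists_unimodular_binary_reduction (N : ℕ) : ∀ A B C : ℤ, 0 < A → A.toNat ≤ N →
    0 < A * C - B ^ 2 → ∃ p q r s : ℤ, p * s - q * r = 1 ∧
      0 < A * p ^ 2 + 2 * B * p * r + C * r ^ 2 ∧
      3 * (A * p ^ 2 + 2 * B * p * r + C * r ^ 2) ^ 2 ≤ 4 * (A * C - B ^ 2) := by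
  induction N with
  | zero => intro A B C hA hN; omega
  | succ N ih =>
    intro A B C hA hN hD
    obtain ⟨k, hk1, hk2⟩ := exists_shift_two_mul_abs_le A hA B
    have hD' : A * (C + 2 * k * B + k ^ 2 * A) - (B + k * A) ^ 2 = A * C - B ^ 2 := by ring
    generalize hB' : B + k * A = B' at *
    generalize hC' : C + 2 * k * B + k ^ 2 * A = C' at *
    have hC'pos : 0 < C' :=
      (pos_iff_pos_of_mul_pos (a := A) (by linarith [sq_nonneg B'])).mp hA
    by_cases hlt : C' < A
    · obtain ⟨p, q, r, s, h1, h2, h3⟩ := ih C' (-B') A hC'pos (by omega) (by linarith)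
      have hval : A * (-r + k * p) ^ 2 + 2 * B * (-r + k * p) * p + C * p ^ 2 =
          C' * p ^ 2 + 2 * -B' * p * r + A * r ^ 2 := by
        rw [← hB', ← hC']; ring
      refine ⟨-r + k * p, -s + k * q, p, q, by linarith, ?_, ?_⟩
      · rwa [hval]
      · rw [hval]; linarith
    · refine ⟨1, 0, 0, 1, by norm_num, by simpa using hA, ?_⟩
      simp only [one_pow, mul_one, mul_zero, add_zero, ne_eq, OfNat.ofNat_ne_zero,
        not_false_eq_true, zero_pow]
      rw [← hD']
      linarith [mul_le_mul_of_nonneg_left (not_lt.mp hlt) hA.le,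
        mul_nonneg (sub_nonneg.mpr hk1) (sub_nonneg.mpr hk2)]

theorem eq_one_of_three_mul_sq_le {a c : ℤ} (ha : 0 < a) (hac : 3 * a ^ 2 ≤ 4 * c)
    (hca : 3 * c ^ 2 ≤ 4 * a) : a = 1 := by
  by_contra hne
  have ha2 : 2 ≤ a := by omega
  have h1 : (3 * a ^ 2) ^ 2 ≤ (4 * c) ^ 2 := pow_le_pow_left₀ (by positivity) hac 2
  have h2 : (2 : ℤ) ^ 3 ≤ a ^ 3 := pow_le_pow_left₀ (by norm_num) ha2 3
  linarith [mul_le_mul_of_nonneg_left h2 ha.le]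

/-- A positive definite integral ternary form of determinant one only represents sums of three
squares; the proof is Hermite reduction. -/
theorem sum_three_squares_of_unimodular_ternary_form (N : ℕ) : ∀ a b c d e f : ℤ, 0 < a →
    a.toNat ≤ N → 0 < a * b - f ^ 2 →
    a * b * c + 2 * d * e * f - a * d ^ 2 - b * e ^ 2 - c * f ^ 2 = 1 →
    ∀ x y z : ℤ, ∃ u v w : ℤ, a * x ^ 2 + b * y ^ 2 + c * z ^ 2 + 2 * d * y * z + 2 * e * x * z +
      2 * f * x * y = u ^ 2 + v ^ 2 + w ^ 2 := by
  induction N with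
  | zero => intro a b c d e f ha hN; omega
  | succ N ih =>
    intro a b c d e f ha hN hA hdet x y z
    have hdisc : (a * b - f ^ 2) * (a * c - e ^ 2) - (a * d - e * f) ^ 2 = a := by
      linear_combination a * hdet
    obtain ⟨p, q, r, s, h1, h2, h3⟩ := exists_unimodular_binary_reduction _ (a * b - f ^ 2)
      (a * d - e * f) (a * c - e ^ 2) hA le_rfl (by rw [hdisc]; exact ha)
    rw [hdisc] at h3
    obtain ⟨k, hk1, hk2⟩ := exists_shift_two_mul_abs_le a ha (f * p + e * r)
    obtain ⟨f', hf'⟩ : ∃ f', f' = f * p + e * r + k * a := ⟨_, rfl⟩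
    obtain ⟨b', hb'⟩ : ∃ b', b' = b * p ^ 2 + 2 * d * p * r + c * r ^ 2 +
      2 * k * (f * p + e * r) + k ^ 2 * a := ⟨_, rfl⟩
    obtain ⟨e', he'⟩ : ∃ e', e' = f * q + e * s := ⟨_, rfl⟩
    obtain ⟨c', hc'⟩ : ∃ c', c' = b * q ^ 2 + 2 * d * q * s + c * s ^ 2 := ⟨_, rfl⟩
    obtain ⟨d', hd'⟩ : ∃ d', d' = b * p * q + d * (p * s + q * r) + c * r * s + k * e' := ⟨_, rfl⟩
    rw [← hf'] at hk1 hk2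
    have hA' : (a * b - f ^ 2) * p ^ 2 + 2 * (a * d - e * f) * p * r + (a * c - e ^ 2) * r ^ 2 =
        a * b' - f' ^ 2 := by rw [hf', hb']; ring
    rw [hA'] at h2 h3
    have hdet' : a * b' * c' + 2 * d' * e' * f' - a * d' ^ 2 - b' * e' ^ 2 - c' * f' ^ 2 = 1 := by
      have : a * b' * c' + 2 * d' * e' * f' - a * d' ^ 2 - b' * e' ^ 2 - c' * f' ^ 2 =
          (a * b * c + 2 * d * e * f - a * d ^ 2 - b * e ^ 2 - c * f ^ 2) *
            (p * s - q * r) ^ 2 := by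
        rw [hd', he', hf', hb', hc']; ring
      rw [this, hdet, h1]; norm_num
    obtain ⟨y', hy'⟩ : ∃ y', y' = s * y - q * z := ⟨_, rfl⟩
    obtain ⟨z', hz'⟩ : ∃ z', z' = -r * y + p * z := ⟨_, rfl⟩
    obtain ⟨x', hx'⟩ : ∃ x', x' = x - k * y' := ⟨_, rfl⟩
    have hy : y = p * y' + q * z' := by rw [hy', hz']; linear_combination -y * h1
    have hz : z = r * y' + s * z' := by rw [hy', hz']; linear_combination -z * h1
    have hx : x = x' + k * y' := by rw [hx']; ring
    have hval : a * x ^ 2 + b * y ^ 2 + c * z ^ 2 + 2 * d * y * z + 2 * e * x * z +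
        2 * f * x * y = a * x' ^ 2 + b' * y' ^ 2 + c' * z' ^ 2 + 2 * d' * y' * z' +
          2 * e' * x' * z' + 2 * f' * x' * y' := by
      clear hx' hy' hz'
      rw [hx, hy, hz, hd', he', hf', hb', hc']; ring
    rw [hval]
    have hb'pos : 0 < b' :=
      (pos_iff_pos_of_mul_pos (a := a) (by linarith [sq_nonneg f'])).mp ha
    by_cases hlt : b' < a
    · obtain ⟨u, v, w, huvw⟩ := ih b' a c' e' d' f' hb'pos (by omega) (by linarith) (by linarith)
        y' x' z'
      exact ⟨u, v, w, by rw [← huvw]; ring⟩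
    · have h4 : 3 * a ^ 2 ≤ 4 * (a * b' - f' ^ 2) := by
        linarith [mul_le_mul_of_nonneg_left (not_lt.mp hlt) ha.le,
          mul_nonneg (sub_nonneg.mpr hk1) (sub_nonneg.mpr hk2)]
      have ha1 : a = 1 := eq_one_of_three_mul_sq_le ha h4 h3
      subst ha1
      obtain rfl : f' = 0 := by omega
      have h5 : 3 * b' ^ 2 ≤ 4 := by simpa using h3
      obtain rfl : b' = 1 := eq_one_of_three_mul_sq_le hb'pos (c := 1) (by linarith) (by linarith)
      exact ⟨x' + e' * z', y' + d' * z', z', by linear_combination z' ^ 2 * hdet'⟩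

open NumberTheorySymbols in
theorem exists_dvd_sq_add_of_jacobiSym_eq_one {p b : ℕ} (hp : p.Prime) (hb : Odd b)
    (hmod : p % 4 = 1 ∨ p % 4 = 3 ∧ b % 4 = 3) (h : J(p | b) = 1) :
    ∃ k : ℤ, (p : ℤ) ∣ k ^ 2 + b := by
  have := Fact.mk hp
  have hodd : Odd p := by rw [Nat.odd_iff]; omega
  have key : J(-b | p) = 1 := by
    rw [neg_eq_neg_one_mul, jacobiSym.mul_left, jacobiSym.at_neg_one hodd]
    rcases hmod with h1 | ⟨h1, h3⟩
    · rw [ZMod.χ₄_nat_one_mod_four h1, one_mul,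
        ← jacobiSym.quadratic_reciprocity_one_mod_four h1 hb, h]
    · rw [ZMod.χ₄_nat_three_mod_four h1, jacobiSym.quadratic_reciprocity_three_mod_four h3 h1, h]
      norm_num
  obtain ⟨x, hx⟩ := ZMod.isSquare_of_jacobiSym_eq_one key
  obtain ⟨k, rfl⟩ := ZMod.intCast_surjective x
  refine ⟨k, (ZMod.intCast_zmod_eq_zero_iff_dvd _ p).mp ?_⟩
  push_cast at hx ⊢
  rw [pow_two, ← hx]
  ring

/-- `n` is a sum of three integer squares. -/
def IsSumThreeSquares (n : ℤ) : Prop := ∃ x y z : ℤ, n = x ^ 2 + y ^ 2 + z ^ 2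

theorem isSumThreeSquares_of_dvd {n b k : ℤ} (hb : 0 < b) (hbn : 0 < b * n - 1)
    (h : b * n - 1 ∣ k ^ 2 + b) : IsSumThreeSquares n := by
  obtain ⟨a, ha⟩ := h
  have hapos : 0 < a :=
    (pos_iff_pos_of_mul_pos (by rw [← ha]; positivity)).mp hbn
  obtain ⟨u, v, w, h⟩ := sum_three_squares_of_unimodular_ternary_form a.toNat a (b * n - 1) n 0 1 k
    hapos le_rfl (by linarith) (by linear_combination -n * ha) 0 0 1
  exact ⟨u, v, w, by rw [← h]; ring⟩

theorem exists_prime_eq_add_mul {m r : ℕ} (hm : m ≠ 0) (h : r.Coprime m) :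
    ∃ v : ℕ, (r + m * v).Prime := by
  obtain ⟨p, hgt, hp, hmod⟩ := Nat.forall_exists_prime_gt_and_modEq r hm h
  obtain ⟨v, hv⟩ := (Nat.modEq_iff_dvd' hgt.le).mp hmod.symm
  exact ⟨v, by rwa [← hv, Nat.add_sub_cancel' hgt.le]⟩

theorem isSumThreeSquares_of_mod_four_eq_two {n : ℕ} (hn : n % 4 = 2) :
    IsSumThreeSquares n := by
  have hcop : (n - 1).Coprime (4 * n) := by
    rw [Nat.coprime_mul_iff_right]
    constructor
    · have hodd : Odd (n - 1) := by rw [Nat.odd_iff]; omega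
      exact (Nat.coprime_two_right.mpr hodd).pow_right 2
    · exact (Nat.coprime_self_sub_left (by omega)).mpr (by simp)
  obtain ⟨v, hp⟩ := exists_prime_eq_add_mul (by omega) hcop
  have heq : ((n - 1 + 4 * n * v : ℕ) : ℤ) = (4 * v + 1 : ℕ) * n - 1 := by
    push_cast [show 1 ≤ n by omega]; ring
  generalize hpdef : n - 1 + 4 * n * v = p at *
  have hmod : p % 4 = 1 := by rw [← hpdef, mul_assoc]; omega
  have hb : Odd (4 * v + 1) := by rw [Nat.odd_iff]; omega
  obtain ⟨k, hk⟩ := exists_dvd_sq_add_of_jacobiSym_eq_one hp hb (Or.inl hmod) (by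
    rw [heq, jacobiSym.mod_left' (a₂ := -1), jacobiSym.at_neg_one hb,
      ZMod.χ₄_nat_one_mod_four (by omega)]
    rw [sub_eq_add_neg, Int.mul_add_emod_self_left])
  rw [heq] at hk
  exact isSumThreeSquares_of_dvd (by positivity) (by rw [← heq]; exact_mod_cast hp.pos) hk

open NumberTheorySymbols in
theorem isSumThreeSquares_of_odd {n c : ℕ} (h : n % 8 = 1 ∧ c = 3 ∨ n % 8 = 3 ∧ c = 1 ∨
    n % 8 = 5 ∧ c = 3) : IsSumThreeSquares n := by
  obtain ⟨r, hr⟩ : ∃ r, 2 * r + 1 = c * n := by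
    refine ⟨(c * n - 1) / 2, ?_⟩
    rcases h with ⟨h, rfl⟩ | ⟨h, rfl⟩ | ⟨h, rfl⟩ <;> omega
  have hrodd : r % 2 = 1 := by
    rcases h with ⟨h, rfl⟩ | ⟨h, rfl⟩ | ⟨h, rfl⟩ <;> omega
  have hcop : r.Coprime (4 * n) := by
    rw [Nat.coprime_mul_iff_right]
    constructor
    · exact (Nat.coprime_two_right.mpr (Nat.odd_iff.mpr hrodd)).pow_right 2
    · rw [← Nat.isCoprime_iff_coprime]
      refine ⟨-2, c, ?_⟩
      have : (2 * r + 1 : ℤ) = c * n := mod_cast hr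
      linear_combination -this
  obtain ⟨v, hp⟩ := exists_prime_eq_add_mul (by omega) hcop
  have heq : 2 * ((r + 4 * n * v : ℕ) : ℤ) = (8 * v + c : ℕ) * n - 1 := by
    have : (2 * r + 1 : ℤ) = c * n := mod_cast hr
    push_cast; linear_combination this
  generalize hpdef : r + 4 * n * v = p at *
  have hpmod : p % 4 = r % 4 := by rw [← hpdef, mul_assoc]; omega
  generalize hbdef : 8 * v + c = b at *
  have hbodd : Odd b := by
    rw [Nat.odd_iff]
    rcases h with ⟨h, rfl⟩ | ⟨h, rfl⟩ | ⟨h, rfl⟩ <;> omega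
  have hmod : p % 4 = 1 ∨ p % 4 = 3 ∧ b % 4 = 3 := by
    rcases h with ⟨h, rfl⟩ | ⟨h, rfl⟩ | ⟨h, rfl⟩ <;> omega
  have h2 : J(2 | b) = J(-1 | b) ∧ J(-1 | b) ≠ 0 := by
    rw [jacobiSym.at_two hbodd, jacobiSym.at_neg_one hbodd, ZMod.χ₈_nat_eq_if_mod_eight,
      ZMod.χ₄_nat_eq_if_mod_four]
    have : b % 8 = 1 ∨ b % 8 = 3 := by omega
    rcases this with h8 | h8
    · simp [h8, show b % 2 = 1 by omega, show b % 4 = 1 by omega]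
    · simp [h8, show b % 2 = 1 by omega, show b % 4 = 3 by omega]
  have hJ : J(p | b) = 1 := by
    have : J(2 * p | b) = J(-1 | b) := by
      rw [heq]
      apply jacobiSym.mod_left'
      rw [sub_eq_add_neg, Int.mul_add_emod_self_left]
    rw [jacobiSym.mul_left, h2.1] at this
    exact mul_left_cancel₀ h2.2 (by rw [this, mul_one])
  obtain ⟨k, hk⟩ := exists_dvd_sq_add_of_jacobiSym_eq_one hp hbodd hmod hJ
  have hpodd : p % 2 = 1 := by omega
  obtain ⟨k, hk, hk2⟩ : ∃ k : ℤ, (p : ℤ) ∣ k ^ 2 + b ∧ (2 : ℤ) ∣ k ^ 2 + b := by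
    have key : ∀ k : ℤ, (k + b) % 2 = 0 → (2 : ℤ) ∣ k ^ 2 + b := fun k hk => by
      have : (2 : ℤ) ∣ k * (k - 1) := (Int.even_mul_pred_self k).two_dvd
      rw [show k ^ 2 + (b : ℤ) = k * (k - 1) + (k + b) by ring]
      exact dvd_add this (Int.dvd_of_emod_eq_zero hk)
    by_cases hpar : (k + b) % 2 = 0
    · exact ⟨k, hk, key k hpar⟩
    · refine ⟨k + p, ?_, key _ (by omega)⟩
      rw [show (k + p) ^ 2 + (b : ℤ) = k ^ 2 + b + p * (2 * k + p) by ring]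
      exact dvd_add hk (dvd_mul_right _ _)
  have hdvd : (2 * p : ℤ) ∣ k ^ 2 + b :=
    IsCoprime.mul_dvd ((Nat.isCoprime_iff_coprime (m := 2)).mpr
      (Nat.coprime_two_left.mpr (Nat.odd_iff.mpr hpodd))) hk2 hk
  rw [heq] at hdvd
  exact isSumThreeSquares_of_dvd (mod_cast hbodd.pos)
    (by rw [← heq]; exact_mod_cast mul_pos two_pos hp.pos) hdvd

theorem isSumThreeSquares_of_mod_eight {n : ℕ} (h0 : n % 4 ≠ 0) (h7 : n % 8 ≠ 7) :
    IsSumThreeSquares n := by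
  by_cases h2 : n % 4 = 2
  · exact isSumThreeSquares_of_mod_four_eq_two h2
  · have : n % 8 = 1 ∨ n % 8 = 3 ∨ n % 8 = 5 := by omega
    rcases this with h | h | h
    · exact isSumThreeSquares_of_odd (c := 3) (by omega)
    · exact isSumThreeSquares_of_odd (c := 1) (by omega)
    · exact isSumThreeSquares_of_odd (c := 3) (by omega)

theorem IsSumThreeSquares.sq_mul {n : ℤ} (h : IsSumThreeSquares n) (c : ℤ) :
    IsSumThreeSquares (c ^ 2 * n) := by
  obtain ⟨x, y, z, rfl⟩ := h
  exact ⟨c * x, c * y, c * z, by ring⟩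

theorem IsSumThreeSquares.of_emod_eight {n : ℤ} (hn : 0 ≤ n) (h0 : n % 4 ≠ 0) (h7 : n % 8 ≠ 7) :
    IsSumThreeSquares n := by
  lift n to ℕ using hn
  exact isSumThreeSquares_of_mod_eight (by omega) (by omega)

theorem IsSumThreeSquares.exists_not_dvd_three (N : ℕ) : ∀ n : ℤ, 0 < n → n.toNat ≤ N →
    IsSumThreeSquares n → ∃ x y z : ℤ, n = x ^ 2 + y ^ 2 + z ^ 2 ∧ ¬ 3 ∣ x := by
  induction N with
  | zero => intro n hn hN; omega
  | succ N ih =>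
    rintro n hn hN ⟨x, y, z, h⟩
    by_cases hx : (3 : ℤ) ∣ x
    swap
    · exact ⟨x, y, z, h, hx⟩
    by_cases hy : (3 : ℤ) ∣ y
    swap
    · exact ⟨y, x, z, by rw [h]; ring, hy⟩
    by_cases hz : (3 : ℤ) ∣ z
    swap
    · exact ⟨z, x, y, by rw [h]; ring, hz⟩
    obtain ⟨x, rfl⟩ := hx
    obtain ⟨y, rfl⟩ := hy
    obtain ⟨z, rfl⟩ := hz
    have hn' : n = 9 * (x ^ 2 + y ^ 2 + z ^ 2) := by rw [h]; ring
    generalize hM : x ^ 2 + y ^ 2 + z ^ 2 = M at hn'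
    obtain ⟨u, v, w, huvw, hu⟩ := ih M (by omega) (by omega) ⟨x, y, z, hM.symm⟩
    by_cases h1 : (3 : ℤ) ∣ u + 2 * v + 2 * w
    · by_cases h2 : (3 : ℤ) ∣ u - 2 * v + 2 * w
      · refine ⟨u - 2 * v - 2 * w, 2 * u - v + 2 * w, 2 * u + 2 * v - w, ?_, by omega⟩
        rw [hn', huvw]; ring
      · refine ⟨u - 2 * v + 2 * w, 2 * u - v - 2 * w, 2 * u + 2 * v + w, ?_, h2⟩
        rw [hn', huvw]; ring
    · refine ⟨u + 2 * v + 2 * w, 2 * u + v - 2 * w, 2 * u - 2 * v + w, ?_, h1⟩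
      rw [hn', huvw]; ring

theorem sq_emod_three (a : ℤ) : 3 ∣ a ∧ a ^ 2 % 3 = 0 ∨ ¬ 3 ∣ a ∧ a ^ 2 % 3 = 1 := by
  have : a % 3 = 0 ∨ a % 3 = 1 ∨ a % 3 = 2 := by omega
  rcases this with h | h | h <;> simp [pow_two, Int.mul_emod, h] <;> omega

/-- `n` is a sum of four squares `x ^ 2 + y ^ 2 + z ^ 2 + w ^ 2` with `x + 2 * y + 2 * z = s`. -/
def IsRestrictedSum (n s : ℤ) : Prop :=
  ∃ x y z w : ℤ, n = x ^ 2 + y ^ 2 + z ^ 2 + w ^ 2 ∧ x + 2 * y + 2 * z = s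

theorem exists_sq_eq_and_dvd_sub {s a : ℤ} (hs : ¬ 3 ∣ s) (ha : ¬ 3 ∣ a) :
    ∃ b : ℤ, b ^ 2 = a ^ 2 ∧ 3 ∣ b - s := by
  by_cases h : (3 : ℤ) ∣ a - s
  · exact ⟨a, rfl, h⟩
  · have hs' : s % 3 = 1 ∨ s % 3 = 2 := by omega
    have ha' : a % 3 = 1 ∨ a % 3 = 2 := by omega
    exact ⟨-a, by ring, by omega⟩

theorem isRestrictedSum_three_mul_of_dvd {n s u v w : ℤ}
    (h : n - s ^ 2 = u ^ 2 + v ^ 2 + w ^ 2) (hd : 3 ∣ s - u - v) : IsRestrictedSum n (3 * s) := by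
  obtain ⟨k, hk⟩ := hd
  obtain rfl : s = u + v + 3 * k := by linarith
  exact ⟨u + v + k, u + 2 * k, v + 2 * k, w, by linear_combination h, by ring⟩

theorem isRestrictedSum_three_mul {n s : ℤ} (hpos : 0 < n - s ^ 2)
    (h : IsSumThreeSquares (n - s ^ 2)) : IsRestrictedSum n (3 * s) := by
  obtain ⟨x, y, z, h, hx⟩ := h.exists_not_dvd_three _ _ hpos le_rfl
  by_cases hs : (3 : ℤ) ∣ s
  · by_cases hy : (3 : ℤ) ∣ y
    · by_cases hz : (3 : ℤ) ∣ z
      · exact isRestrictedSum_three_mul_of_dvd (u := y) (v := z) (w := x) (by rw [h]; ring)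
          (by omega)
      · obtain ⟨t, ht, htd⟩ := exists_sq_eq_and_dvd_sub hx hz
        exact isRestrictedSum_three_mul_of_dvd (u := x) (v := -t) (w := y)
          (by rw [h, ← ht]; ring) (by omega)
    · obtain ⟨t, ht, htd⟩ := exists_sq_eq_and_dvd_sub hx hy
      exact isRestrictedSum_three_mul_of_dvd (u := x) (v := -t) (w := z)
        (by rw [h, ← ht]; ring) (by omega)
  · obtain ⟨t, ht, htd⟩ := exists_sq_eq_and_dvd_sub hs hx
    by_cases hy : (3 : ℤ) ∣ y
    · exact isRestrictedSum_three_mul_of_dvd (u := t) (v := y) (w := z)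
        (by rw [h, ← ht]) (by omega)
    · obtain ⟨r, hr, hrd⟩ := exists_sq_eq_and_dvd_sub hs hy
      exact isRestrictedSum_three_mul_of_dvd (u := -t) (v := -r) (w := z)
        (by rw [h, ← ht, ← hr]; ring) (by omega)

theorem isRestrictedSum_of_dvd_of_not_dvd {n s a b c : ℤ} (hs : ¬ 3 ∣ s)
    (h : 9 * n - s ^ 2 = a ^ 2 + b ^ 2 + c ^ 2) (ha : ¬ 3 ∣ a) (hb : ¬ 3 ∣ b) (hc : 3 ∣ c) :
    IsRestrictedSum n s := by
  obtain ⟨w, rfl⟩ := hc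
  obtain ⟨u, hu, hud⟩ := exists_sq_eq_and_dvd_sub hs ha
  obtain ⟨v, hv, hvd⟩ := exists_sq_eq_and_dvd_sub hs hb
  obtain ⟨i, hi⟩ := hud
  obtain ⟨j, hj⟩ := hvd
  obtain rfl : u = s + 3 * i := by linarith
  obtain rfl : v = s + 3 * j := by linarith
  rw [← hu, ← hv] at h
  have hmul : (3 : ℤ) ∣ s * (s + 2 * (i + j)) :=
    ⟨n - w ^ 2 - i ^ 2 - j ^ 2, by linarith⟩
  obtain ⟨k, hk⟩ := (Int.prime_three.dvd_mul.mp hmul).resolve_left hs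
  obtain rfl : s = 3 * k - 2 * (i + j) := by linarith
  exact ⟨-k, k - i, k - j, w, by linarith, by ring⟩

theorem isRestrictedSum_of_not_dvd {n s : ℤ} (hs : ¬ 3 ∣ s)
    (h : IsSumThreeSquares (9 * n - s ^ 2)) : IsRestrictedSum n s := by
  obtain ⟨a, b, c, h⟩ := h
  rcases sq_emod_three s with ⟨hs', -⟩ | ⟨-, hs3⟩
  · exact absurd hs' hs
  rcases sq_emod_three a with ⟨ha, ha3⟩ | ⟨ha, ha3⟩ <;>
  rcases sq_emod_three b with ⟨hb, hb3⟩ | ⟨hb, hb3⟩ <;>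
  rcases sq_emod_three c with ⟨hc, hc3⟩ | ⟨hc, hc3⟩ <;> first
  | exact isRestrictedSum_of_dvd_of_not_dvd hs h ha hb hc
  | exact isRestrictedSum_of_dvd_of_not_dvd (a := a) (b := c) (c := b) hs (by rw [h]; ring) ha hc hb
  | exact isRestrictedSum_of_dvd_of_not_dvd (a := b) (b := c) (c := a) hs (by rw [h]; ring) hb hc ha
  | omega

theorem IsRestrictedSum.sq_mul {n s : ℤ} (h : IsRestrictedSum n s) (c : ℤ) :
    IsRestrictedSum (c ^ 2 * n) (c * s) := by
  obtain ⟨x, y, z, w, rfl, rfl⟩ := h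
  exact ⟨c * x, c * y, c * z, c * w, by ring, by ring⟩

theorem IsSumThreeSquares.isRestrictedSum_zero {n : ℕ} (h : IsSumThreeSquares n) :
    IsRestrictedSum n 0 := by
  rcases n.eq_zero_or_pos with rfl | hn
  · exact ⟨0, 0, 0, 0, by norm_num, by norm_num⟩
  · exact isRestrictedSum_three_mul (s := 0) (by simpa using hn) (by simpa using h)

theorem isSumThreeSquares_of_not_modEq {n : ℕ} (h7 : n % 8 ≠ 7) (h28 : n % 32 ≠ 28)
    (h16 : n % 16 ≠ 0) : IsSumThreeSquares n := by
  by_cases h4 : n % 4 = 0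
  · obtain ⟨q, rfl⟩ := Nat.dvd_of_mod_eq_zero h4
    simpa using (isSumThreeSquares_of_mod_eight (n := q) (by omega) (by omega)).sq_mul 2
  · exact isSumThreeSquares_of_mod_eight h4 h7

theorem isRestrictedSum_self {n : ℕ} (h : n % 8 = 7 ∨ n % 32 = 28) {d : ℤ}
    (hd : d = 1 ∨ d = 2 ∨ d = 3) : IsRestrictedSum n d := by
  rcases hd with rfl | rfl | rfl
  · exact isRestrictedSum_of_not_dvd (by norm_num)
      (.of_emod_eight (by omega) (by omega) (by omega))
  · refine isRestrictedSum_of_not_dvd (by norm_num) ?_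
    by_cases h4 : n % 4 = 0
    · obtain ⟨q, rfl⟩ := Nat.dvd_of_mod_eq_zero h4
      have := (IsSumThreeSquares.of_emod_eight (n := 9 * q - 1) (by omega) (by omega)
        (by omega)).sq_mul 2
      convert this using 1
      push_cast; ring
    · exact .of_emod_eight (by omega) (by omega) (by omega)
  · exact isRestrictedSum_three_mul (s := 1) (by omega)
      (.of_emod_eight (by omega) (by omega) (by omega))

theorem exists_isRestrictedSum_mul_sq {d : ℤ} (hd : d = 1 ∨ d = 2 ∨ d = 3) (n : ℕ) :
    ∃ t : ℤ, IsRestrictedSum n (d * t ^ 2) := by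
  induction n using Nat.strong_induction_on with
  | _ n ih =>
    rcases n.eq_zero_or_pos with rfl | hn
    · exact ⟨0, 0, 0, 0, 0, by norm_num, by norm_num⟩
    by_cases h : n % 8 = 7 ∨ n % 32 = 28
    · exact ⟨1, by simpa using isRestrictedSum_self h hd⟩
    by_cases h16 : n % 16 = 0
    · obtain ⟨q, rfl⟩ := Nat.dvd_of_mod_eq_zero h16
      obtain ⟨t, ht⟩ := ih q (by omega)
      refine ⟨2 * t, ?_⟩
      convert ht.sq_mul 4 using 1 <;> push_cast <;> ring
    · exact ⟨0, by simpa using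
        (isSumThreeSquares_of_not_modEq (by omega) (by omega) h16).isRestrictedSum_zero⟩

theorem exists_isRestrictedSum_mul_cube_of_sixteen_mul {q : ℕ} (hq : q % 4 ≠ 0) {d : ℤ}
    (hd : d = 1 ∨ d = 2 ∨ d = 3) : ∃ t : ℤ, IsRestrictedSum (16 * q : ℕ) (d * t ^ 3) := by
  by_cases h7 : q % 8 = 7
  swap
  · refine ⟨0, ?_⟩
    have := (isSumThreeSquares_of_mod_eight hq h7).sq_mul 4
    simpa using IsSumThreeSquares.isRestrictedSum_zero (n := 16 * q) (by simpa using this)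
  rcases hd with rfl | rfl | rfl
  · refine ⟨2, isRestrictedSum_of_not_dvd (by norm_num) ?_⟩
    convert (IsSumThreeSquares.of_emod_eight (n := 9 * q - 4) (by omega) (by omega)
      (by omega)).sq_mul 4 using 1
    push_cast; ring
  · refine ⟨1, isRestrictedSum_of_not_dvd (by norm_num) ?_⟩
    convert (IsSumThreeSquares.of_emod_eight (n := 36 * q - 1) (by omega) (by omega)
      (by omega)).sq_mul 2 using 1
    push_cast; ring
  · refine ⟨2, isRestrictedSum_three_mul (s := 8) (by omega) ?_⟩
    convert (IsSumThreeSquares.of_emod_eight (n := q - 4) (by omega) (by omega)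
      (by omega)).sq_mul 4 using 1
    push_cast; ring

theorem exists_isRestrictedSum_mul_cube {d : ℤ} (hd : d = 1 ∨ d = 2 ∨ d = 3) (n : ℕ) :
    ∃ t : ℤ, IsRestrictedSum n (d * t ^ 3) := by
  induction n using Nat.strong_induction_on with
  | _ n ih =>
    rcases n.eq_zero_or_pos with rfl | hn
    · exact ⟨0, 0, 0, 0, 0, by norm_num, by norm_num⟩
    by_cases h : n % 8 = 7 ∨ n % 32 = 28
    · exact ⟨1, by simpa using isRestrictedSum_self h hd⟩
    by_cases h64 : n % 64 = 0
    · obtain ⟨q, rfl⟩ := Nat.dvd_of_mod_eq_zero h64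
      obtain ⟨t, ht⟩ := ih q (by omega)
      refine ⟨2 * t, ?_⟩
      convert ht.sq_mul 8 using 1 <;> push_cast <;> ring
    by_cases h16 : n % 16 = 0
    · obtain ⟨q, rfl⟩ := Nat.dvd_of_mod_eq_zero h16
      exact exists_isRestrictedSum_mul_cube_of_sixteen_mul (by omega) hd
    · exact ⟨0, by simpa using
        (isSumThreeSquares_of_not_modEq (by omega) (by omega) h16).isRestrictedSum_zero⟩

theorem stmt_3 (d : ℤ) (hd : d = 1 ∨ d = 2 ∨ d = 3) (m : ℕ) (hm : m = 2 ∨ m = 3) (n : ℕ) :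
    ∃ x y z w : ℤ, (n : ℤ) = x ^ 2 + y ^ 2 + z ^ 2 + w ^ 2 ∧
      ∃ t : ℤ, x + 2 * y + 2 * z = d * t ^ m := by
  rcases hm with rfl | rfl
  · obtain ⟨t, x, y, z, w, hn, hs⟩ := exists_isRestrictedSum_mul_sq hd n
    exact ⟨x, y, z, w, hn, t, hs⟩
  · obtain ⟨t, x, y, z, w, hn, hs⟩ := exists_isRestrictedSum_mul_cube hd n
    exact ⟨x, y, z, w, hn, t, hs⟩
end

section
/- Let a, b, c, d be integers, not all zero, let λ ∈ {1,2} and m ∈ {2,3}, and set N = a^2 + b^2 + c^2 + d^2. Then every natural number n can be written as n = x^2 + y^2 + z^2 + w^2 where x, y, z, w are rational numbers such that N·x, N·y, N·z, N·w are all integers, and a·x + b·y + c·z + d·w = λ·r^m for some nonnegative integer r. -/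
/-- If `1` is a square root of `-D` modulo `n` and `n` is a square modulo the nonsquare `D`, then
the conic `n z² = w² + D y²` has a rational point with `z ≠ 0`. -/
lemma exists_mul_sq_eq_sq_add_mul_sq {n D : ℕ} {t : ℤ} (hn : 0 < n) (hD : ¬IsSquare D)
    (h1 : (n : ℤ) ∣ D + 1) (h2 : (D : ℤ) ∣ t ^ 2 - n) :
    ∃ w y z : ℤ, z ≠ 0 ∧ (n : ℤ) * z ^ 2 = w ^ 2 + D * y ^ 2 := by
  have hD0 : 0 < D := Nat.pos_of_ne_zero fun h => hD ⟨0, by simp [h]⟩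
  have : NeZero n := ⟨hn.ne'⟩
  have : NeZero D := ⟨hD0.ne'⟩
  let A := Nat.sqrt (n * D)
  let B := Nat.sqrt n
  let C := Nat.sqrt D
  have hA : n * D < (A + 1) * (A + 1) := Nat.lt_succ_sqrt (n * D)
  have hB : n < (B + 1) * (B + 1) := Nat.lt_succ_sqrt n
  have hC : D < (C + 1) * (C + 1) := Nat.lt_succ_sqrt D
  have hA' : A * A ≤ n * D := Nat.sqrt_le _
  have hB' : B * B ≤ n := Nat.sqrt_le _
  have hC' : C * C ≤ D := Nat.sqrt_le _
  have hbox : n * D < (A + 1) * ((B + 1) * (C + 1)) := by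
    refine lt_of_pow_lt_pow_left₀ 2 (Nat.zero_le _) ?_
    calc (n * D) ^ 2 = (n * D) * (n * D) := by ring
      _ < ((A + 1) * (A + 1)) * (((B + 1) * (B + 1)) * ((C + 1) * (C + 1))) := by gcongr
      _ = ((A + 1) * ((B + 1) * (C + 1))) ^ 2 := by ring
  let S := Finset.range (A + 1) ×ˢ Finset.range (B + 1) ×ˢ Finset.range (C + 1)
  let f : ℕ × ℕ × ℕ → ZMod n × ZMod D := fun p =>
    (((p.1 : ℤ) - p.2.1 : ℤ), ((p.1 : ℤ) - t * p.2.2 : ℤ))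
  obtain ⟨p, hp, p', hp', hne, hf⟩ : ∃ p ∈ S, ∃ p' ∈ S, p ≠ p' ∧ f p = f p' := by
    refine Finset.exists_ne_map_eq_of_card_lt_of_maps_to (t := Finset.univ) ?_
      (fun _ _ => Finset.mem_coe.2 (Finset.mem_univ _))
    simpa [S, Finset.card_product, ZMod.card] using hbox
  obtain ⟨a, b, c⟩ := p
  obtain ⟨a', b', c'⟩ := p'
  simp only [S, Finset.mem_product, Finset.mem_range] at hp hp'
  simp only [f, Prod.mk.injEq, ZMod.intCast_eq_intCast_iff_dvd_sub] at hf
  obtain ⟨hfn, hfD⟩ := hf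
  obtain ⟨w, hw⟩ : ∃ w : ℤ, w = a' - a := ⟨_, rfl⟩
  obtain ⟨y, hy⟩ : ∃ y : ℤ, y = b' - b := ⟨_, rfl⟩
  obtain ⟨z, hz⟩ : ∃ z : ℤ, z = c' - c := ⟨_, rfl⟩
  have hwy : (n : ℤ) ∣ w - y := by convert hfn using 1; rw [hw, hy]; ring
  have hwz : (D : ℤ) ∣ w - t * z := by convert hfD using 1; rw [hw, hz]; ring
  have h0 : ¬(w = 0 ∧ y = 0 ∧ z = 0) := by
    rintro ⟨h, h', h''⟩
    apply hne
    simp only [Prod.mk.injEq]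
    omega
  have hw2 : w ^ 2 ≤ n * D := by
    have : w ^ 2 ≤ (A : ℤ) ^ 2 := sq_le_sq' (by omega) (by omega)
    zify at hA'; linarith
  have hy2 : y ^ 2 ≤ n := by
    have : y ^ 2 ≤ (B : ℤ) ^ 2 := sq_le_sq' (by omega) (by omega)
    zify at hB'; linarith
  have hz2 : z ^ 2 ≤ D := by
    have : z ^ 2 ≤ (C : ℤ) ^ 2 := sq_le_sq' (by omega) (by omega)
    zify at hC'; linarith
  have hnZ : (0 : ℤ) < n := by exact_mod_cast hn
  have hDZ : (0 : ℤ) < D := by exact_mod_cast hD0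
  have hDsq : ∀ u : ℤ, u ^ 2 ≠ D := by
    intro u hu
    refine hD ⟨u.natAbs, ?_⟩
    zify
    rw [← hu, ← sq, sq_abs]
  have hzD : z ^ 2 < D := lt_of_le_of_ne hz2 (hDsq z)
  have hdn : (n : ℤ) ∣ w ^ 2 + D * y ^ 2 - n * z ^ 2 := by
    obtain ⟨i, hi⟩ := hwy
    obtain ⟨j, hj⟩ := h1
    obtain rfl : w = y + n * i := by linarith
    exact ⟨y ^ 2 * j + 2 * y * i + n * i ^ 2 - z ^ 2, by linear_combination y ^ 2 * hj⟩
  have hdD : (D : ℤ) ∣ w ^ 2 + D * y ^ 2 - n * z ^ 2 := by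
    obtain ⟨i, hi⟩ := hwz
    obtain ⟨j, hj⟩ := h2
    obtain rfl : w = t * z + D * i := by linarith
    exact ⟨z ^ 2 * j + 2 * t * z * i + D * i ^ 2 + y ^ 2, by linear_combination z ^ 2 * hj⟩
  have hcop : IsCoprime (n : ℤ) D := by
    obtain ⟨j, hj⟩ := h1
    exact ⟨j, -1, by linear_combination -hj⟩
  obtain ⟨k, hk⟩ := hcop.mul_dvd hdn hdD
  have hnD : (0 : ℤ) < n * D := mul_pos hnZ hDZ
  have hk0 : -1 < k := by
    by_contra! h
    have h3 : (n : ℤ) * z ^ 2 < n * D := by gcongr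
    have h4 : (n : ℤ) * D * k ≤ n * D * -1 := by gcongr
    linarith [sq_nonneg w, mul_nonneg hDZ.le (sq_nonneg y)]
  have hk2 : k < 2 := by
    by_contra! h
    have h3 : (D : ℤ) * y ^ 2 ≤ D * n := by gcongr
    have h4 : 0 ≤ (n : ℤ) * z ^ 2 := by positivity
    have h8 : (n : ℤ) * D * 2 ≤ n * D * k := by gcongr
    have h5 : w ^ 2 = n * D := by linarith
    have h6 : (D : ℤ) * y ^ 2 = D * n := by linarith
    have h7 : y ^ 2 = n := mul_left_cancel₀ hDZ.ne' h6
    have hy0 : y ≠ 0 := by rintro rfl; norm_num at h7; omega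
    rw [← h7] at h5
    obtain ⟨u, rfl⟩ : y ∣ w := (Int.pow_dvd_pow_iff two_ne_zero).1 ⟨_, h5⟩
    rw [mul_pow] at h5
    exact hDsq u (mul_left_cancel₀ (pow_ne_zero 2 hy0) h5)
  obtain rfl | rfl : k = 0 ∨ k = 1 := by omega
  · refine ⟨w, y, z, ?_, by linarith⟩
    rintro rfl
    have h3 : 0 ≤ (D : ℤ) * y ^ 2 := by positivity
    have h4 : w ^ 2 = 0 := by linarith [sq_nonneg w]
    have h5 : (D : ℤ) * y ^ 2 = 0 := by linarith [sq_nonneg w]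
    refine h0 ⟨by simpa using h4, ?_, rfl⟩
    simpa [hD0.ne'] using h5
  · refine ⟨w * z - D * y, w + y * z, z ^ 2 + D, by positivity, ?_⟩
    linear_combination -(z ^ 2 + D) * hk

/-- The **Davenport–Cassels lemma** for sums of three squares: an integer which is a sum of three
rational squares is a sum of three integer squares. -/
lemma sum_three_sq_of_mul_sq (n : ℤ) (T : ℕ) (hT : 0 < T) (x y z : ℤ)
    (h : n * (T : ℤ) ^ 2 = x ^ 2 + y ^ 2 + z ^ 2) :
    ∃ u v w : ℤ, n = u ^ 2 + v ^ 2 + w ^ 2 := by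
  induction T using Nat.strong_induction_on generalizing x y z with
  | _ T ih =>
  have hTZ : (0 : ℤ) < T := by exact_mod_cast hT
  have near : ∀ a : ℤ, ∃ b : ℤ, 4 * (T * b - a) ^ 2 ≤ (T : ℤ) ^ 2 := by
    intro a
    refine ⟨(2 * a + T) / (2 * T), ?_⟩
    have e := Int.mul_ediv_add_emod (2 * a + T) (2 * T)
    have l := Int.emod_nonneg (2 * a + T) (b := 2 * T) (by omega)
    have u := Int.emod_lt_of_pos (2 * a + T) (b := 2 * T) (by omega)
    set b := (2 * a + T) / (2 * T)
    have : (2 * (T * b - a)) ^ 2 ≤ (T : ℤ) ^ 2 := sq_le_sq' (by linarith) (by linarith)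
    linarith
  obtain ⟨X, hX⟩ := near x
  obtain ⟨Y, hY⟩ := near y
  obtain ⟨Z, hZ⟩ := near z
  set p := X ^ 2 + Y ^ 2 + Z ^ 2 - n with hp
  set q := 2 * (n * T - (x * X + y * Y + z * Z)) with hq
  have key : (T : ℤ) * (p * T + q) = (T * X - x) ^ 2 + (T * Y - y) ^ 2 + (T * Z - z) ^ 2 := by
    rw [hp, hq]; linear_combination h
  have hnn : 0 ≤ p * T + q := by
    refine nonneg_of_mul_nonneg_right ?_ hTZ
    rw [key]; positivity
  have hlt : p * T + q < T := by
    refine lt_of_mul_lt_mul_left (a := (T : ℤ)) ?_ hTZ.le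
    linarith [mul_pos hTZ hTZ]
  obtain h0 | hpos := hnn.eq_or_lt
  · rw [← h0, mul_zero] at key
    have hx2 := sq_nonneg (T * X - x)
    have hy2 := sq_nonneg (T * Y - y)
    have hz2 := sq_nonneg (T * Z - z)
    have hx : (T * X - x) ^ 2 = 0 := by linarith
    have hy : (T * Y - y) ^ 2 = 0 := by linarith
    have hz : (T * Z - z) ^ 2 = 0 := by linarith
    obtain rfl : T * X = x := by simpa [sub_eq_zero] using hx
    obtain rfl : T * Y = y := by simpa [sub_eq_zero] using hy
    obtain rfl : T * Z = z := by simpa [sub_eq_zero] using hz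
    refine ⟨X, Y, Z, mul_right_cancel₀ (pow_ne_zero 2 hTZ.ne') ?_⟩
    rw [h]; ring
  · obtain ⟨T', hT'⟩ := Int.eq_ofNat_of_zero_le hnn
    refine ih T' (by omega) (by omega) (p * x + q * X) (p * y + q * Y) (p * z + q * Z) ?_
    rw [← hT', hp, hq]
    linear_combination (X ^ 2 + Y ^ 2 + Z ^ 2 - n) ^ 2 * h

lemma sum_three_sq_of_dvd {n D : ℕ} {t e f : ℤ} (hn : 0 < n) (hD : ¬IsSquare D)
    (h1 : (n : ℤ) ∣ D + 1) (h2 : (D : ℤ) ∣ t ^ 2 - n) (hDef : (D : ℤ) = e ^ 2 + f ^ 2) :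
    ∃ u v w : ℤ, (n : ℤ) = u ^ 2 + v ^ 2 + w ^ 2 := by
  obtain ⟨w, y, z, hz, h⟩ := exists_mul_sq_eq_sq_add_mul_sq hn hD h1 h2
  refine sum_three_sq_of_mul_sq n z.natAbs (Int.natAbs_pos.2 hz) w (e * y) (f * y) ?_
  rw [Int.natAbs_sq, h, hDef]; ring

open scoped NumberTheorySymbols in
lemma jacobiSym_eq_of_dvd_sub {a b : ℤ} {n : ℕ} (h : (n : ℤ) ∣ a - b) : J(a | n) = J(b | n) :=
  jacobiSym.mod_left' (Int.modEq_iff_dvd.2 h).symm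

open scoped NumberTheorySymbols in
lemma exists_dvd_sq_sub_of_jacobiSym_eq_one {q : ℕ} (hq : q.Prime) {a : ℤ} (h : J(a | q) = 1) :
    ∃ t : ℤ, (q : ℤ) ∣ t ^ 2 - a := by
  have := Fact.mk hq
  obtain ⟨s, hs⟩ := ZMod.isSquare_of_jacobiSym_eq_one h
  obtain ⟨t, rfl⟩ := ZMod.intCast_surjective s
  refine ⟨t, (ZMod.intCast_zmod_eq_zero_iff_dvd _ _).1 ?_⟩
  push_cast
  rw [hs]; ring

lemma exists_intCast_eq_sq_add_sq {q : ℕ} (hq : q.Prime) (h : q % 4 = 1) :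
    ∃ e f : ℤ, (q : ℤ) = e ^ 2 + f ^ 2 := by
  have := Fact.mk hq
  obtain ⟨e, f, h⟩ := Nat.Prime.sq_add_sq (p := q) (by omega)
  exact ⟨e, f, by exact_mod_cast h.symm⟩

open scoped NumberTheorySymbols in
lemma sum_three_sq_of_mod_four_eq_one {n : ℕ} (h : n % 4 = 1) :
    ∃ u v w : ℤ, (n : ℤ) = u ^ 2 + v ^ 2 + w ^ 2 := by
  have hcop : (2 * n - 1).Coprime (4 * n) := by
    have : IsCoprime ((2 * n - 1 : ℕ) : ℤ) ((4 * n : ℕ) : ℤ) := by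
      rw [Nat.cast_sub (by omega)]
      push_cast
      exact ⟨2 * n - 1, -(n - 1), by ring⟩
    exact Nat.isCoprime_iff_coprime.1 this
  obtain ⟨q, -, hq, hmod⟩ := Nat.forall_exists_prime_gt_and_modEq 0 (by omega) hcop
  have hq4 : q % 4 = 1 := by
    have := hmod.of_mul_right n
    unfold Nat.ModEq at this
    omega
  have hdvd : (n : ℤ) ∣ q + 1 := by
    have h1 := (Nat.modEq_iff_dvd.1 (hmod.of_mul_left 4).symm)
    rw [Nat.cast_sub (by omega)] at h1
    obtain ⟨i, hi⟩ := h1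
    exact ⟨i + 2, by push_cast at hi ⊢; linear_combination hi⟩
  have hnodd : Odd n := Nat.odd_iff.2 (by omega)
  have hJ : J((n : ℤ) | q) = 1 := by
    rw [jacobiSym.quadratic_reciprocity_one_mod_four h (Nat.odd_iff.2 (by omega)),
      jacobiSym_eq_of_dvd_sub (b := -1) (by simpa using hdvd),
      jacobiSym.at_neg_one hnodd, ZMod.χ₄_nat_one_mod_four h]
  obtain ⟨t, ht⟩ := exists_dvd_sq_sub_of_jacobiSym_eq_one hq hJ
  obtain ⟨e, f, hef⟩ := exists_intCast_eq_sq_add_sq hq hq4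
  exact sum_three_sq_of_dvd (by omega) hq.prime.not_isSquare hdvd ht hef

open scoped NumberTheorySymbols in
lemma sum_three_sq_of_mod_eight_eq_three {n : ℕ} (h : n % 8 = 3) :
    ∃ u v w : ℤ, (n : ℤ) = u ^ 2 + v ^ 2 + w ^ 2 := by
  obtain ⟨k, rfl⟩ : ∃ k, n = 8 * k + 3 := ⟨n / 8, by omega⟩
  have hcop : (4 * k + 1).Coprime (4 * (8 * k + 3)) := by
    have : IsCoprime ((4 * k + 1 : ℕ) : ℤ) ((4 * (8 * k + 3) : ℕ) : ℤ) := by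
      push_cast
      refine IsCoprime.mul_right ⟨1, -k, by ring⟩ ⟨-2, 1, by ring⟩
    exact Nat.isCoprime_iff_coprime.1 this
  obtain ⟨q, -, hq, hmod⟩ := Nat.forall_exists_prime_gt_and_modEq 0 (by omega) hcop
  have hq4 : q % 4 = 1 := by
    have := hmod.of_mul_right (8 * k + 3)
    unfold Nat.ModEq at this
    omega
  have hdvd : ((8 * k + 3 : ℕ) : ℤ) ∣ (2 * q : ℕ) + 1 := by
    have h1 := (Nat.modEq_iff_dvd.1 (hmod.of_mul_left 4).symm)
    obtain ⟨i, hi⟩ := h1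
    exact ⟨2 * i + 1, by push_cast at hi ⊢; linear_combination 2 * hi⟩
  set n := 8 * k + 3 with hn
  have hnodd : Odd n := Nat.odd_iff.2 (by omega)
  have hJ : J((n : ℤ) | q) = 1 := by
    rw [jacobiSym.quadratic_reciprocity_one_mod_four' hnodd hq4]
    have h2q : J(((2 * q : ℕ) : ℤ) | n) = J(-1 | n) :=
      jacobiSym_eq_of_dvd_sub (by simpa using hdvd)
    push_cast at h2q
    rw [jacobiSym.mul_left, jacobiSym.at_neg_one hnodd, jacobiSym.at_two hnodd,
      ZMod.χ₄_nat_three_mod_four (by omega), ZMod.χ₈_nat_eq_if_mod_eight,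
      if_neg (by omega), if_neg (by omega)] at h2q
    linarith
  obtain ⟨t, ht⟩ := exists_dvd_sq_sub_of_jacobiSym_eq_one hq hJ
  obtain ⟨e, f, hef⟩ := exists_intCast_eq_sq_add_sq hq hq4
  have hcop2 : IsCoprime (2 : ℤ) q := by
    rw [Int.isCoprime_iff_gcd_eq_one]
    exact (Nat.coprime_primes Nat.prime_two hq).2 (by omega)
  obtain ⟨s, hs, hs2⟩ : ∃ s : ℤ, (q : ℤ) ∣ s ^ 2 - n ∧ Odd s := by
    obtain heven | hodd := Int.even_or_odd t
    · refine ⟨t + q, ?_, heven.add_odd (by rw [Int.odd_iff]; omega)⟩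
      obtain ⟨i, hi⟩ := ht
      exact ⟨i + 2 * t + q, by linear_combination hi⟩
    · exact ⟨t, ht, hodd⟩
  have h2s : (2 : ℤ) ∣ s ^ 2 - n := by
    rw [← even_iff_two_dvd]
    exact hs2.pow.sub_odd (by exact_mod_cast hnodd)
  refine sum_three_sq_of_dvd (D := 2 * q) (t := s) (e := e - f) (f := e + f) (by omega) ?_ hdvd
    (by push_cast; exact hcop2.mul_dvd h2s hs) (by push_cast; rw [hef]; ring)
  rintro ⟨r, hr⟩
  have : 2 * q % 4 = 2 := by omega
  rw [hr, Nat.mul_mod] at this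
  have : r % 4 < 4 := Nat.mod_lt _ (by norm_num)
  interval_cases r % 4 <;> simp_all

open scoped NumberTheorySymbols in
lemma sum_three_sq_of_mod_four_eq_two {n : ℕ} (h : n % 4 = 2) :
    ∃ u v w : ℤ, (n : ℤ) = u ^ 2 + v ^ 2 + w ^ 2 := by
  obtain ⟨k, rfl⟩ : ∃ k, n = 2 * k := ⟨n / 2, by omega⟩
  have hcop : (2 * k - 1).Coprime (4 * (2 * k)) := by
    have : IsCoprime ((2 * k - 1 : ℕ) : ℤ) ((4 * (2 * k) : ℕ) : ℤ) := by
      rw [Nat.cast_sub (by omega)]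
      push_cast
      refine IsCoprime.mul_right ?_ ⟨-1, 1, by ring⟩
      obtain ⟨j, hj⟩ : ∃ j, k = 2 * j + 1 := ⟨k / 2, by omega⟩
      rw [hj]
      push_cast
      refine ⟨1, -j, by ring⟩
    exact Nat.isCoprime_iff_coprime.1 this
  obtain ⟨q, -, hq, hmod⟩ := Nat.forall_exists_prime_gt_and_modEq 0 (by omega) hcop
  have hq8 : q % 8 = (2 * k - 1) % 8 := by
    have := Nat.ModEq.of_mul_right k (n := 8) (by convert hmod using 1; ring)
    exact this
  have hdvd : ((2 * k : ℕ) : ℤ) ∣ q + 1 := by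
    have h1 := (Nat.modEq_iff_dvd.1 (hmod.of_mul_left 4).symm)
    rw [Nat.cast_sub (by omega)] at h1
    obtain ⟨i, hi⟩ := h1
    exact ⟨i + 1, by push_cast at hi ⊢; linear_combination hi⟩
  have hkodd : Odd k := Nat.odd_iff.2 (by omega)
  have hqodd : Odd q := Nat.odd_iff.2 (by omega)
  have hkdvd : (k : ℤ) ∣ q + 1 := (Int.natCast_dvd_natCast.2 (dvd_mul_left k 2)).trans hdvd
  have hJ : J(((2 * k : ℕ) : ℤ) | q) = 1 := by
    push_cast
    rw [jacobiSym.mul_left, jacobiSym.quadratic_reciprocity_one_mod_four' hkodd (by omega),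
      jacobiSym_eq_of_dvd_sub (a := q) (b := -1) (by simpa using hkdvd),
      jacobiSym.at_neg_one hkodd, jacobiSym.at_two hqodd, ZMod.χ₈_nat_eq_if_mod_eight,
      if_neg (by omega)]
    obtain h1 | h3 : k % 4 = 1 ∨ k % 4 = 3 := by omega
    · rw [ZMod.χ₄_nat_one_mod_four h1, if_pos (by omega), one_mul]
    · rw [ZMod.χ₄_nat_three_mod_four h3, if_neg (by omega)]; norm_num
  obtain ⟨t, ht⟩ := exists_dvd_sq_sub_of_jacobiSym_eq_one hq hJ
  obtain ⟨e, f, hef⟩ := exists_intCast_eq_sq_add_sq hq (by omega)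
  exact sum_three_sq_of_dvd (by omega) hq.prime.not_isSquare hdvd ht hef

/-- **Legendre's three-square theorem** for integers not divisible by `4`. -/
theorem sum_three_sq {n : ℕ} (h4 : n % 4 ≠ 0) (h8 : n % 8 ≠ 7) :
    ∃ u v w : ℤ, (n : ℤ) = u ^ 2 + v ^ 2 + w ^ 2 := by
  obtain h | h | h : n % 4 = 1 ∨ n % 4 = 2 ∨ n % 8 = 3 := by omega
  exacts [sum_three_sq_of_mod_four_eq_one h, sum_three_sq_of_mod_four_eq_two h,
    sum_three_sq_of_mod_eight_eq_three h]

/-- Every natural number is a sum of four squares, one of which is the square of `l * r ^ m`. -/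
lemma exists_sq_mul_pow_add_three_sq {l : ℤ} (hl : l = 1 ∨ l = 2) {m : ℕ} (hm : m = 2 ∨ m = 3)
    (n : ℕ) : ∃ (r : ℕ) (u v w : ℤ), (n : ℤ) = (l * r ^ m) ^ 2 + u ^ 2 + v ^ 2 + w ^ 2 := by
  induction n using Nat.strong_induction_on with
  | _ n ih =>
  have hm0 : m ≠ 0 := by omega
  obtain rfl | hn := Nat.eq_zero_or_pos n
  · exact ⟨0, 0, 0, 0, by simp [hm0]⟩
  by_cases hdvd : 4 ^ m ∣ n
  · obtain ⟨k, rfl⟩ := hdvd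
    have h4 : 1 < 4 ^ m := Nat.one_lt_pow hm0 (by norm_num)
    obtain ⟨r, u, v, w, h⟩ := ih k (by nlinarith [Nat.pos_of_mul_pos_left hn])
    refine ⟨2 * r, 2 ^ m * u, 2 ^ m * v, 2 ^ m * w, ?_⟩
    have : (4 : ℤ) ^ m = (2 ^ m) ^ 2 := by rw [← pow_mul, mul_comm, pow_mul]; norm_num
    push_cast
    rw [h, this, mul_pow]; ring
  · have step : ∀ (r s k : ℕ), k % 4 ≠ 0 → k % 8 ≠ 7 → (n : ℤ) = (l * r ^ m) ^ 2 + s ^ 2 * k →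
        ∃ (r : ℕ) (u v w : ℤ), (n : ℤ) = (l * r ^ m) ^ 2 + u ^ 2 + v ^ 2 + w ^ 2 := by
      intro r s k h4 h8 h
      obtain ⟨u, v, w, hk⟩ := sum_three_sq h4 h8
      exact ⟨r, s * u, s * v, s * w, by rw [h, hk]; ring⟩
    have hzero : (l * ((0 : ℕ) : ℤ) ^ m) ^ 2 = 0 := by simp [hm0]
    by_cases h4 : n % 4 ≠ 0
    · by_cases h8 : n % 8 ≠ 7
      · exact step 0 1 n h4 h8 (by rw [hzero]; ring)
      · obtain rfl | rfl := hl
        · exact step 1 1 (n - 1) (by omega) (by omega) (by push_cast [hn]; ring)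
        · refine step 1 1 (n - 4) (by omega) (by omega) ?_
          rw [Nat.cast_sub (by omega)]; push_cast; ring
    obtain ⟨k, rfl⟩ : ∃ k, n = 4 * k := ⟨n / 4, by omega⟩
    by_cases hk4 : k % 4 ≠ 0
    · by_cases h8 : k % 8 ≠ 7
      · exact step 0 2 k hk4 h8 (by rw [hzero]; push_cast; ring)
      · obtain rfl | rfl := hl
        · refine step 1 1 (4 * k - 1) (by omega) (by omega) ?_
          rw [Nat.cast_sub (by omega)]; push_cast; ring
        · refine step 1 2 (k - 1) (by omega) (by omega) ?_
          rw [Nat.cast_sub (by omega)]; push_cast; ring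
    obtain ⟨j, rfl⟩ : ∃ j, k = 4 * j := ⟨k / 4, by omega⟩
    obtain rfl : m = 3 := hm.resolve_left (by rintro rfl; exact hdvd ⟨j, by ring⟩)
    have hj4 : j % 4 ≠ 0 := fun h => hdvd (by omega)
    by_cases h8 : j % 8 ≠ 7
    · exact step 0 4 j hj4 h8 (by rw [hzero]; push_cast; ring)
    · obtain rfl | rfl := hl
      · refine step 2 4 (j - 4) (by omega) (by omega) ?_
        rw [Nat.cast_sub (by omega)]; push_cast; ring
      · refine step 1 2 (4 * j - 1) (by omega) (by omega) ?_
        rw [Nat.cast_sub (by omega)]; push_cast; ring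

theorem stmt_6 (a b c d : ℤ) (habcd : ¬(a = 0 ∧ b = 0 ∧ c = 0 ∧ d = 0))
    (l : ℤ) (hl : l = 1 ∨ l = 2) (m : ℕ) (hm : m = 2 ∨ m = 3) (n : ℕ) :
    ∃ x y z w : ℚ, (n : ℚ) = x ^ 2 + y ^ 2 + z ^ 2 + w ^ 2 ∧
      (∃ X : ℤ, ((a ^ 2 + b ^ 2 + c ^ 2 + d ^ 2 : ℤ) : ℚ) * x = (X : ℚ)) ∧
      (∃ Y : ℤ, ((a ^ 2 + b ^ 2 + c ^ 2 + d ^ 2 : ℤ) : ℚ) * y = (Y : ℚ)) ∧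
      (∃ Z : ℤ, ((a ^ 2 + b ^ 2 + c ^ 2 + d ^ 2 : ℤ) : ℚ) * z = (Z : ℚ)) ∧
      (∃ W : ℤ, ((a ^ 2 + b ^ 2 + c ^ 2 + d ^ 2 : ℤ) : ℚ) * w = (W : ℚ)) ∧
      ∃ r : ℕ, (a : ℚ) * x + (b : ℚ) * y + (c : ℚ) * z + (d : ℚ) * w
        = (l : ℚ) * (r : ℚ) ^ m := by
  obtain ⟨N, hN⟩ : ∃ N : ℤ, N = a ^ 2 + b ^ 2 + c ^ 2 + d ^ 2 := ⟨_, rfl⟩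
  have hN0 : N ≠ 0 := by
    intro h0
    rw [h0] at hN
    refine habcd ⟨?_, ?_, ?_, ?_⟩ <;> refine pow_eq_zero_iff two_ne_zero |>.1 ?_ <;>
      nlinarith [sq_nonneg a, sq_nonneg b, sq_nonneg c, sq_nonneg d]
  have hNn : 0 ≤ N := by rw [hN]; positivity
  obtain ⟨r, t, u, v, h⟩ := exists_sq_mul_pow_add_three_sq hl hm (N.toNat * n)
  obtain ⟨s, hs⟩ : ∃ s : ℤ, s = l * r ^ m := ⟨_, rfl⟩
  rw [← hs] at h
  push_cast at h
  rw [Int.toNat_of_nonneg hNn] at h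
  have hNQ : (N : ℚ) ≠ 0 := by exact_mod_cast hN0
  have hQ : (N : ℚ) * n = s ^ 2 + t ^ 2 + u ^ 2 + v ^ 2 := by exact_mod_cast h
  have hN' : (N : ℚ) = a ^ 2 + b ^ 2 + c ^ 2 + d ^ 2 := by rw [hN]; push_cast; rfl
  rw [← hN]
  -- The conjugate of the quaternion `s + ti + uj + vk` times `a + bi + cj + dk`, divided by `N`.
  refine ⟨(a * s + b * t + c * u + d * v : ℤ) / N, (b * s - a * t + d * u - c * v : ℤ) / N,
    (c * s - d * t - a * u + b * v : ℤ) / N, (d * s + c * t - b * u - a * v : ℤ) / N, ?_,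
    ⟨_, mul_div_cancel₀ _ hNQ⟩, ⟨_, mul_div_cancel₀ _ hNQ⟩, ⟨_, mul_div_cancel₀ _ hNQ⟩,
    ⟨_, mul_div_cancel₀ _ hNQ⟩, r, ?_⟩
  · push_cast
    field_simp
    linear_combination (N : ℚ) * hQ + (s ^ 2 + t ^ 2 + u ^ 2 + v ^ 2 : ℚ) * hN'
  · have hsQ : (s : ℚ) = l * r ^ m := by rw [hs]; push_cast; rfl
    rw [← hsQ]
    push_cast
    field_simp
    linear_combination -(s : ℚ) * hN'
end
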